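/- Let K be an algebraically closed field of characteristic zero and F ∈ K[x,y,z] a form of degree d. If F = c₁·ℓ₁^d + ⋯ + c_r·ℓ_r^d where each ℓ_i is a linear form whose coefficient of x is nonzero (i.e., ∂ℓ_i/∂x ≠ 0), then r ≥ al(F) − al(∂F/∂x), where al denotes apolar length. -/

import Mathlib

open MvPolynomial

/-- The span of all `n`-th order partial derivatives of a ternary polynomial `F`
(with variables `x = X 0`, `y = X 1`, `z = X 2`). -/
noncomputable def derivSpan (K : Type*) [CommSemiring K] (n : ℕ)
    (F : MvPolynomial (Fin 3) K) : Submodule K (MvPolynomial (Fin 3) K) :=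
  Submodule.span K {G | ∃ i j l : ℕ, i + j + l = n ∧
    G = (⇑(pderiv (0 : Fin 3)))^[i] ((⇑(pderiv (1 : Fin 3)))^[j]
          ((⇑(pderiv (2 : Fin 3)))^[l] F))}

/-- The apolar length of `F`: the sum over all `n ≥ 0` of the dimensions of the
spans of the `n`-th order partial derivatives of `F`. -/
noncomputable def apolarLength (K : Type*) [Field K]
    (F : MvPolynomial (Fin 3) K) : ℕ :=
  ∑ n ∈ Finset.range (F.totalDegree + 1), Module.finrank K (derivSpan K n F)

/-- The vectors of values at the points `(p 0 i, p 1 i, p 2 i)` of the ternary forms of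
degree `n`. -/
def formValues {K ι : Type*} [CommSemiring K] (p : Fin 3 → ι → K) (n : ℕ) :
    Submodule K (ι → K) :=
  Submodule.span K {v | ∃ i j l : ℕ, i + j + l = n ∧ v = p 0 ^ i * (p 1 ^ j * p 2 ^ l)}

/-- The linear map sending `v` to the `n`-th order derivative of `∑ i, c i • ℓ i ^ d` by a
differential form of degree `n` taking the value `v i` at the point dual to `ℓ i`. -/
noncomputable def powerSumDeriv {K σ ι : Type*} [CommSemiring K] [Fintype ι] (d : ℕ)
    (c : ι → K) (ℓ : ι → MvPolynomial σ K) (n : ℕ) : (ι → K) →ₗ[K] MvPolynomial σ K :=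
  Fintype.linearCombination K fun i => (c i * d.descFactorial n) • ℓ i ^ (d - n)

theorem powerSumDeriv_apply {K σ ι : Type*} [CommSemiring K] [Fintype ι] (d : ℕ)
    (c : ι → K) (ℓ : ι → MvPolynomial σ K) (n : ℕ) (v : ι → K) :
    powerSumDeriv d c ℓ n v = ∑ i, v i • (c i * d.descFactorial n) • ℓ i ^ (d - n) :=
  Fintype.linearCombination_apply ..

theorem MvPolynomial.IsHomogeneous.pderiv_eq_C_coeff {K σ : Type*} [CommSemiring K]
    {f : MvPolynomial σ K} (hf : f.IsHomogeneous 1) (s : σ) :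
    pderiv s f = C (f.coeff (Finsupp.single s 1)) := by
  have h : (pderiv s f).IsHomogeneous 0 := hf.pderiv
  rw [← totalDegree_zero_iff_isHomogeneous, totalDegree_eq_zero_iff_eq_C] at h
  rw [h, coeff_pderiv]
  simp

section

variable {K σ ι : Type*} [CommSemiring K] [Fintype ι] {d : ℕ} {c : ι → K}
  {ℓ : ι → MvPolynomial σ K} {p : σ → ι → K}

theorem pderiv_powerSumDeriv (hp : ∀ s i, pderiv s (ℓ i) = C (p s i)) (s : σ) (n : ℕ)
    (v : ι → K) :
    pderiv s (powerSumDeriv d c ℓ n v) = powerSumDeriv d c ℓ (n + 1) (p s * v) := by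
  simp only [powerSumDeriv_apply, map_sum, Derivation.map_smul]
  refine Finset.sum_congr rfl fun i _ => ?_
  rw [Derivation.leibniz_pow, hp, Nat.descFactorial_succ, Nat.sub_sub]
  simp only [smul_eq_C_mul, smul_eq_mul, nsmul_eq_mul, Pi.mul_apply, map_mul, Nat.cast_mul,
    map_natCast]
  ring

theorem iterate_pderiv_powerSumDeriv (hp : ∀ s i, pderiv s (ℓ i) = C (p s i)) (s : σ)
    (k n : ℕ) (v : ι → K) :
    (⇑(pderiv s))^[k] (powerSumDeriv d c ℓ n v) =
      powerSumDeriv d c ℓ (n + k) (p s ^ k * v) := by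
  induction k with
  | zero => simp
  | succ k ih =>
    rw [Function.iterate_succ_apply', ih, pderiv_powerSumDeriv hp, pow_succ', mul_assoc,
      add_assoc]

end

theorem derivSpan_powerSumDeriv {K ι : Type*} [CommSemiring K] [Fintype ι] {d : ℕ} {c : ι → K}
    {ℓ : ι → MvPolynomial (Fin 3) K} {p : Fin 3 → ι → K}
    (hp : ∀ s i, pderiv s (ℓ i) = C (p s i)) (m n : ℕ) (v : ι → K) :
    derivSpan K n (powerSumDeriv d c ℓ m v) =
      ((formValues p n).map (LinearMap.mulRight K v)).map (powerSumDeriv d c ℓ (m + n)) := by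
  rw [derivSpan, formValues, Submodule.map_span, Submodule.map_span]
  congr 1
  ext G
  simp only [iterate_pderiv_powerSumDeriv hp, Set.mem_image, Set.mem_ofPred_eq]
  constructor
  · rintro ⟨i, j, l, rfl, rfl⟩
    refine ⟨_, ⟨_, ⟨i, j, l, rfl, rfl⟩, rfl⟩, ?_⟩
    rw [LinearMap.mulRight_apply, mul_assoc, mul_assoc]
    congr 2
    omega
  · rintro ⟨_, ⟨_, ⟨i, j, l, rfl, rfl⟩, rfl⟩, rfl⟩
    refine ⟨i, j, l, rfl, ?_⟩
    rw [LinearMap.mulRight_apply, mul_assoc, mul_assoc]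
    congr 2
    omega

theorem finrank_derivSpan_zero_right (K : Type*) [Field K] (n : ℕ) :
    Module.finrank K (derivSpan K n (0 : MvPolynomial (Fin 3) K)) = 0 := by
  suffices h : derivSpan K n (0 : MvPolynomial (Fin 3) K) = ⊥ by rw [h, finrank_bot]
  rw [derivSpan, Submodule.span_eq_bot]
  rintro _ ⟨i, j, l, -, rfl⟩
  simp only [iterate_map_zero]

theorem apolarLength_eq_sum {K : Type*} [Field K] {d : ℕ} {F : MvPolynomial (Fin 3) K}
    (hF : F.IsHomogeneous d) :
    apolarLength K F = ∑ n ∈ Finset.range (d + 1), Module.finrank K (derivSpan K n F) := by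
  rcases eq_or_ne F 0 with rfl | h
  · simp [apolarLength, finrank_derivSpan_zero_right]
  · rw [apolarLength, hF.totalDegree h]

theorem Submodule.finrank_map_add_finrank_le {K V W : Type*} [DivisionRing K]
    [AddCommGroup V] [Module K V] [AddCommGroup W] [Module K W] [FiniteDimensional K V]
    (f : V →ₗ[K] W) {A B : Submodule K V} (h : A ≤ B) :
    Module.finrank K (B.map f) + Module.finrank K A ≤
      Module.finrank K B + Module.finrank K (A.map f) := by
  have rank_nullity (U : Submodule K V) :
      Module.finrank K (U.map f) + Module.finrank K (U ⊓ LinearMap.ker f : Submodule K V) =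
        Module.finrank K U := by
    rw [← LinearMap.finrank_range_add_finrank_ker (f.domRestrict U),
      LinearMap.range_domRestrict, LinearMap.ker_domRestrict,
      ← Submodule.map_comap_subtype,
      ← (Submodule.equivMapOfInjective _ U.injective_subtype _).finrank_eq]
  have hker := Submodule.finrank_mono (inf_le_inf_right (LinearMap.ker f) h)
  have hA := rank_nullity A
  have hB := rank_nullity B
  omega

theorem map_mulRight_formValues_le {K ι : Type*} [CommSemiring K] (p : Fin 3 → ι → K) (n : ℕ) :
    (formValues p n).map (LinearMap.mulRight K (p 0)) ≤ formValues p (n + 1) := by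
  rw [formValues, Submodule.map_span, Submodule.span_le]
  rintro _ ⟨_, ⟨i, j, l, rfl, rfl⟩, rfl⟩
  refine Submodule.subset_span ⟨i + 1, j, l, by omega, ?_⟩
  rw [LinearMap.mulRight_apply]
  ring

theorem sum_finrank_derivSpan_le {K ι : Type*} [Field K] [Fintype ι] {d : ℕ} {c : ι → K}
    {ℓ : ι → MvPolynomial (Fin 3) K} {p : Fin 3 → ι → K}
    (hp : ∀ s i, pderiv s (ℓ i) = C (p s i)) (hx : ∀ i, p 0 i ≠ 0) (k : ℕ) :
    ∑ n ∈ Finset.range (k + 1), Module.finrank K (derivSpan K n (powerSumDeriv d c ℓ 0 1)) ≤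
      Module.finrank K (formValues p k) +
        ∑ n ∈ Finset.range k,
          Module.finrank K (derivSpan K n (pderiv 0 (powerSumDeriv d c ℓ 0 1))) := by
  have span_eq (n : ℕ) : derivSpan K n (powerSumDeriv d c ℓ 0 1) =
      (formValues p n).map (powerSumDeriv d c ℓ n) := by
    rw [derivSpan_powerSumDeriv hp, LinearMap.mulRight_one, Submodule.map_id, zero_add]
  induction k with
  | zero =>
    rw [Finset.sum_range_one, Finset.sum_range_zero, span_eq, add_zero]
    exact Submodule.finrank_map_le (powerSumDeriv d c ℓ 0) (formValues p 0)
  | succ k ih =>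
    have hinj : Function.Injective (LinearMap.mulRight K (p 0)) := fun v w hvw =>
      funext fun i => mul_right_cancel₀ (hx i) (congrFun hvw i)
    have hstep := Submodule.finrank_map_add_finrank_le (powerSumDeriv d c ℓ (k + 1))
      (map_mulRight_formValues_le p k)
    rw [← (Submodule.equivMapOfInjective _ hinj _).finrank_eq] at hstep
    have hspan : derivSpan K k (pderiv 0 (powerSumDeriv d c ℓ 0 1)) =
        ((formValues p k).map (LinearMap.mulRight K (p 0))).map
          (powerSumDeriv d c ℓ (k + 1)) := by
      rw [pderiv_powerSumDeriv hp, derivSpan_powerSumDeriv hp, mul_one, zero_add, add_comm]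
    rw [← span_eq, ← hspan] at hstep
    rw [Finset.sum_range_succ, Finset.sum_range_succ (n := k)
      (f := fun n => Module.finrank K (derivSpan K n (pderiv 0 (powerSumDeriv d c ℓ 0 1))))]
    omega

/-- If `F = c₁·ℓ₁^d + ⋯ + c_r·ℓ_r^d` where every linear form `ℓᵢ` has nonzero
coefficient of `x`, then `r ≥ al(F) − al(∂F/∂x)`. -/
theorem length_lower_bound (K : Type*) [Field K] [IsAlgClosed K] [CharZero K]
    (d : ℕ) (F : MvPolynomial (Fin 3) K) (hF : F.IsHomogeneous d)
    (r : ℕ) (c : Fin r → K) (ℓ : Fin r → MvPolynomial (Fin 3) K)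
    (hhom : ∀ i, (ℓ i).IsHomogeneous 1)
    (hx : ∀ i, (ℓ i).coeff (Finsupp.single 0 1) ≠ 0)
    (hdec : F = ∑ i, c i • ℓ i ^ d) :
    (apolarLength K F : ℤ) - apolarLength K (pderiv 0 F) ≤ r := by
  let p : Fin 3 → Fin r → K := fun s i => (ℓ i).coeff (Finsupp.single s 1)
  have hbound := sum_finrank_derivSpan_le (d := d) (c := c) (p := p)
    (fun s i => (hhom i).pderiv_eq_C_coeff s) hx d
  have hF_eq : powerSumDeriv d c ℓ 0 1 = F := by simp [powerSumDeriv_apply, hdec]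
  rw [hF_eq, ← apolarLength_eq_sum hF] at hbound
  have hle : ∑ n ∈ Finset.range d, Module.finrank K (derivSpan K n (pderiv 0 F)) ≤
      apolarLength K (pderiv 0 F) := by
    rw [apolarLength_eq_sum (hF.pderiv (i := 0))]
    exact Finset.sum_le_sum_of_subset (Finset.range_mono (by omega))
  have hdim : Module.finrank K (formValues p d) ≤ r := by
    simpa using Submodule.finrank_le (formValues p d)
  omega
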